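/- arXiv:1612.07048 — 2 statements merged into one kernel-verified Lean document; each statement's English description precedes it below -/
import Mathlib

section
/- Let S ⊆ ℝ^n be a semialgebraic set for which the closure of the convex cone generated by S in ℝ^n is a spectrahedral shadow. Then there exist a finitely generated reduced commutative ℝ-algebra A, elements a_1, …, a_n ∈ A, and a finite-dimensional ℝ-linear subspace U ⊆ A such that: (1) for every ξ ∈ S there exists an ℝ-algebra homomorphism ρ : A → ℝ with ρ(a_i) = ξ_i for i = 1, …, n; and (2) for every homogeneous linear polynomial f = c_1x_1 + … + c_nx_n with real coefficients satisfying f(ξ) ≥ 0 for all ξ ∈ S, the element c_1a_1 + … + c_na_n of A is a sum of squares of elements of U. -/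
/-- A set `K ⊆ ℝ^k` is a spectrahedral shadow if it is the feasible-region projection of a
symmetric linear matrix inequality. -/
def IsSpectrahedralShadow {k : ℕ} (K : Set (Fin k → ℝ)) : Prop :=
  ∃ (d m : ℕ), 0 < d ∧ ∃ (A : Matrix (Fin d) (Fin d) ℝ)
    (B : Fin k → Matrix (Fin d) (Fin d) ℝ) (C : Fin m → Matrix (Fin d) (Fin d) ℝ),
    A.IsSymm ∧ (∀ i, (B i).IsSymm) ∧ (∀ j, (C j).IsSymm) ∧
    K = {ξ | ∃ η : Fin m → ℝ, (A + ∑ i, ξ i • B i + ∑ j, η j • C j).PosSemidef}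

/-- A set `S ⊆ ℝ^n` is semialgebraic: a finite union of sets given by one polynomial
equation and finitely many strict polynomial inequalities. -/
def IsSemialgebraic {n : ℕ} (S : Set (Fin n → ℝ)) : Prop :=
  ∃ (r : ℕ) (p : Fin r → MvPolynomial (Fin n) ℝ) (s : Fin r → ℕ)
    (q : (i : Fin r) → Fin (s i) → MvPolynomial (Fin n) ℝ),
    S = ⋃ i, {ξ | MvPolynomial.eval ξ (p i) = 0 ∧ ∀ j, 0 < MvPolynomial.eval ξ (q i j)}

/-- The convex cone generated by `M`: all finite nonnegative linear combinations. -/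
def coneGen {k : ℕ} (M : Set (Fin k → ℝ)) : Set (Fin k → ℝ) :=
  {x | ∃ (s : ℕ) (c : Fin s → ℝ) (v : Fin s → (Fin k → ℝ)),
    (∀ i, 0 ≤ c i) ∧ (∀ i, v i ∈ M) ∧ x = ∑ i, c i • v i}

/-- `x` is a sum of squares of elements of the subspace `U`. -/
def IsSumOfSquaresFrom {A : Type*} [CommRing A] [Algebra ℝ A] (U : Submodule ℝ A) (x : A) :
    Prop :=
  ∃ (s : ℕ) (u : Fin s → A), (∀ i, u i ∈ U) ∧ x = ∑ i, u i ^ 2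

/-- The squared Euclidean norm is a proper map. -/
lemma isProperMap_sum_sq {κ : Type*} [Fintype κ] :
    IsProperMap (fun h : κ → ℝ => ∑ k, h k ^ 2) := by
  refine isProperMap_iff_tendsto_cocompact.mpr ⟨by fun_prop, ?_⟩
  refine Filter.Tendsto.mono_right ?_ atTop_le_cocompact
  have hsq : Filter.Tendsto (fun h : κ → ℝ => ‖h‖ ^ 2) (Filter.cocompact _) Filter.atTop :=
    (Filter.tendsto_pow_atTop two_ne_zero).comp tendsto_norm_cocompact_atTop
  refine Filter.tendsto_atTop_mono (fun h => ?_) hsq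
  have hnonneg : 0 ≤ ∑ k, h k ^ 2 := Finset.sum_nonneg fun k _ => sq_nonneg (h k)
  rw [← Real.le_sqrt (norm_nonneg h) hnonneg, pi_norm_le_iff_of_nonneg (Real.sqrt_nonneg _)]
  intro k
  rw [Real.norm_eq_abs]
  exact Real.abs_le_sqrt (Finset.single_le_sum (fun k _ => sq_nonneg (h k)) (Finset.mem_univ k))

/-- Over a finite-dimensional space of vector-valued functions, the pointwise squared norms form
a closed set in the topology of pointwise convergence. -/
lemma isClosed_range_sum_sq {P Z κ : Type*} [AddCommGroup P] [Module ℝ P] [FiniteDimensional ℝ P]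
    [Fintype κ] (T : P →ₗ[ℝ] (Z → κ → ℝ)) :
    IsClosed (Set.range fun p z => ∑ k, T p z k ^ 2) := by
  have hmap : IsClosedMap (fun (h : Z → κ → ℝ) z => ∑ k, h z k ^ 2) :=
    (IsProperMap.pi_map fun _ : Z => isProperMap_sum_sq (κ := κ)).isClosedMap
  have hclosed := hmap _ (LinearMap.range T).closed_of_finiteDimensional
  rwa [LinearMap.coe_range, ← Set.range_comp] at hclosed

lemma Matrix.posSemidef_iff_exists_transpose_mul_self {ι : Type*} [Fintype ι]
    {Q : Matrix ι ι ℝ} : Q.PosSemidef ↔ ∃ W : Matrix ι ι ℝ, Q = W.transpose * W := by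
  classical
  open scoped MatrixOrder in
  rw [← Matrix.nonneg_iff_posSemidef, CStarAlgebra.nonneg_iff_eq_star_mul_self]
  simp only [Matrix.star_eq_conjTranspose, Matrix.conjTranspose_eq_transpose_of_trivial]

lemma Matrix.sum_sq_mul_eq_trace {ι κ : Type*} [Fintype ι] [Fintype κ]
    (W : Matrix ι ι ℝ) (V : Matrix ι κ ℝ) :
    ∑ i, ∑ j, (W * V) i j ^ 2 = (W.transpose * W * (V * V.transpose)).trace := by
  have hcycle : (W.transpose * W * (V * V.transpose)).trace
      = ((W * V) * (W * V).transpose).trace := by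
    rw [Matrix.transpose_mul, Matrix.mul_assoc, Matrix.trace_mul_comm]
    simp only [Matrix.mul_assoc]
  rw [hcycle]
  simp only [Matrix.trace, Matrix.diag, Matrix.mul_apply (M := W * V), Matrix.transpose_apply, sq]

/-- The cone of functions `z ↦ tr (Q * V z * (V z)ᵀ)` with `Q` positive semidefinite. -/
def gramCone {Z ι κ : Type*} [Fintype ι] [Fintype κ] (V : Z → Matrix ι κ ℝ) :
    ProperCone ℝ (Z → ℝ) where
  carrier := {f | ∃ Q : Matrix ι ι ℝ, Q.PosSemidef ∧
    ∀ z, f z = (Q * (V z * (V z).transpose)).trace}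
  zero_mem' := ⟨0, Matrix.PosSemidef.zero, by simp⟩
  add_mem' := by
    rintro f g ⟨Q, hQ, hf⟩ ⟨R, hR, hg⟩
    exact ⟨Q + R, hQ.add hR, fun z => by simp [hf, hg, Matrix.add_mul]⟩
  smul_mem' := by
    rintro ⟨c, hc⟩ f ⟨Q, hQ, hf⟩
    exact ⟨c • Q, hQ.smul hc, fun z => by simp [hf]⟩
  isClosed' := by
    let T : Matrix ι ι ℝ →ₗ[ℝ] (Z → ι × κ → ℝ) :=
      { toFun := fun W z k => (W * V z) k.1 k.2
        map_add' := fun W W' => by ext z k; simp [Matrix.add_mul]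
        map_smul' := fun c W => by ext z k; simp }
    convert isClosed_range_sum_sq T using 1
    ext f
    simp only [Matrix.posSemidef_iff_exists_transpose_mul_self]
    constructor
    · rintro ⟨_, ⟨W, rfl⟩, hf⟩
      refine ⟨W, funext fun z => ?_⟩
      rw [hf, ← Matrix.sum_sq_mul_eq_trace]
      exact Fintype.sum_prod_type _
    · rintro ⟨W, rfl⟩
      refine ⟨_, ⟨W, rfl⟩, fun z => ?_⟩
      rw [← Matrix.sum_sq_mul_eq_trace]
      exact Fintype.sum_prod_type _

/-- A function is either a sum of squares of entries of `W * V z`, or it is separated from all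
such sums by a functional whose moment matrix is positive semidefinite. -/
lemma exists_sum_sq_or_exists_functional {Z ι κ : Type*} [Fintype ι] [Fintype κ]
    (V : Z → Matrix ι κ ℝ) (f : Z → ℝ) :
    (∃ W : Matrix ι ι ℝ, ∀ z, f z = ∑ i, ∑ j, (W * V z) i j ^ 2) ∨
    ∃ ℓ : (Z → ℝ) →ₗ[ℝ] ℝ, ℓ f < 0 ∧
      (Matrix.of fun i j => ℓ fun z => (V z * (V z).transpose) i j).PosSemidef := by
  by_cases hf : f ∈ gramCone V
  · left
    obtain ⟨Q, hQ, hfQ⟩ := hf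
    obtain ⟨W, rfl⟩ := Matrix.posSemidef_iff_exists_transpose_mul_self.mp hQ
    exact ⟨W, fun z => by rw [hfQ, Matrix.sum_sq_mul_eq_trace]⟩
  · right
    obtain ⟨ℓ, hℓ, hℓf⟩ := ProperCone.hyperplane_separation_point _ hf
    refine ⟨ℓ.toLinearMap, hℓf, Matrix.PosSemidef.of_dotProduct_mulVec_nonneg ?_ fun w => ?_⟩
    · ext i j
      have hsymm (z : Z) : (V z * (V z).transpose) j i = (V z * (V z).transpose) i j :=
        by
        rw [← Matrix.transpose_apply (V z * (V z).transpose), Matrix.transpose_mul,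
          Matrix.transpose_transpose]
      simp [hsymm]
    · have hmem : (fun z => w ⬝ᵥ (V z * (V z).transpose).mulVec w) ∈ gramCone V :=
        ⟨Matrix.vecMulVec w (star w), Matrix.posSemidef_vecMulVec_self_star w, fun z => by
          rw [Matrix.vecMulVec_mul, Matrix.trace_vecMulVec, star_trivial,
            dotProduct_comm w (Matrix.vecMul _ _), ← Matrix.dotProduct_mulVec]⟩
      have hfun : (fun z => w ⬝ᵥ (V z * (V z).transpose).mulVec w)
          = ∑ i, ∑ j, (w i * w j) • fun z => (V z * (V z).transpose) i j := by
        ext z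
        simp only [dotProduct, Matrix.mulVec, Finset.mul_sum, Finset.sum_apply, Pi.smul_apply,
          smul_eq_mul]
        exact Finset.sum_congr rfl fun i _ => Finset.sum_congr rfl fun j _ => by ring
      have hnonneg := hℓ _ hmem
      rw [hfun] at hnonneg
      simp only [map_sum, map_smul, smul_eq_mul] at hnonneg
      refine hnonneg.trans_eq ?_
      simp only [dotProduct, Matrix.mulVec, Finset.mul_sum, star_trivial, Matrix.of_apply]
      exact Finset.sum_congr rfl fun i _ => Finset.sum_congr rfl fun j _ => by
        simp only [ContinuousLinearMap.coe_coe]; ring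

lemma isSumOfSquaresFrom_of_sum {A ι : Type*} [CommRing A] [Algebra ℝ A] [Fintype ι]
    {U : Submodule ℝ A} {u : ι → A} (hu : ∀ i, u i ∈ U) : IsSumOfSquaresFrom U (∑ i, u i ^ 2) :=
  ⟨Fintype.card ι, fun i => u ((Fintype.equivFin ι).symm i), fun _ => hu _,
    ((Fintype.equivFin ι).symm.sum_comp fun i => u i ^ 2).symm⟩

/-- Finitely many real functions on a set generate a finitely generated reduced algebra, whose
points include the points of the set. -/
lemma exists_algebra_of_functions {n : ℕ} (S : Set (Fin n → ℝ)) {Z ι κ : Type} [Fintype ι]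
    [Fintype κ] (a : Fin n → Z → ℝ) (V : Z → Matrix ι κ ℝ)
    (hlift : ∀ ξ ∈ S, ∃ z, ∀ i, a i z = ξ i)
    (hsos : ∀ c : Fin n → ℝ, (∀ ξ ∈ S, 0 ≤ ∑ i, c i * ξ i) →
      ∃ W : Matrix ι ι ℝ, ∀ z, ∑ i, c i * a i z = ∑ i, ∑ j, (W * V z) i j ^ 2) :
    ∃ (A : Type) (_ : CommRing A) (_ : Algebra ℝ A),
      Algebra.FiniteType ℝ A ∧ IsReduced A ∧
      ∃ (a : Fin n → A) (U : Submodule ℝ A), FiniteDimensional ℝ U ∧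
        (∀ ξ ∈ S, ∃ ρ : A →ₐ[ℝ] ℝ, ∀ i, ρ (a i) = ξ i) ∧
        (∀ c : Fin n → ℝ, (∀ ξ ∈ S, 0 ≤ ∑ i, c i * ξ i) →
          IsSumOfSquaresFrom U (∑ i, c i • a i)) := by
  let v : ι × κ → Z → ℝ := fun k z => V z k.1 k.2
  let A : Subalgebra ℝ (Z → ℝ) := Algebra.adjoin ℝ (Set.range a ∪ Set.range v)
  have ha (i) : a i ∈ A := Algebra.subset_adjoin (Or.inl ⟨i, rfl⟩)
  have hv (k) : v k ∈ A := Algebra.subset_adjoin (Or.inr ⟨k, rfl⟩)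
  let v' : ι × κ → A := fun k => ⟨v k, hv k⟩
  refine ⟨A, inferInstance, inferInstance, Algebra.FiniteType.adjoin_of_finite
    ((Set.finite_range a).union (Set.finite_range v)),
    isReduced_of_injective A.val Subtype.val_injective, fun i => ⟨a i, ha i⟩,
    Submodule.span ℝ (Set.range v'), FiniteDimensional.span_of_finite ℝ (Set.finite_range v'),
    fun ξ hξ => ?_, fun c hc => ?_⟩
  · obtain ⟨z, hz⟩ := hlift ξ hξ
    exact ⟨(Pi.evalAlgHom ℝ (fun _ : Z => ℝ) z).comp A.val, hz⟩
  · obtain ⟨W, hW⟩ := hsos c hc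
    have hsum : ∑ i, c i • (⟨a i, ha i⟩ : A)
        = ∑ k : ι × κ, (∑ l, W k.1 l • v' (l, k.2)) ^ 2 := by
      refine Subtype.ext (funext fun z => ?_)
      simpa [Fintype.sum_prod_type, v', v, Matrix.mul_apply] using hW z
    rw [hsum]
    exact isSumOfSquaresFrom_of_sum fun k => Submodule.sum_mem _ fun l _ =>
      Submodule.smul_mem _ _ (Submodule.subset_span ⟨_, rfl⟩)

lemma subset_coneGen {n : ℕ} (S : Set (Fin n → ℝ)) : S ⊆ coneGen S :=
  fun ξ hξ => ⟨1, fun _ => 1, fun _ => ξ, fun _ => zero_le_one, fun _ => hξ, by simp⟩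

lemma zero_mem_coneGen {n : ℕ} (S : Set (Fin n → ℝ)) : 0 ∈ coneGen S :=
  ⟨0, Fin.elim0, Fin.elim0, fun i => i.elim0, fun i => i.elim0, by simp⟩

/-- A linear form nonnegative on `S` is nonnegative on the closed convex cone generated by `S`. -/
lemma dotProduct_nonneg_of_mem_closure_coneGen {n : ℕ} {S : Set (Fin n → ℝ)} {c : Fin n → ℝ}
    (hc : ∀ ξ ∈ S, 0 ≤ ∑ i, c i * ξ i) {ξ : Fin n → ℝ} (hξ : ξ ∈ closure (coneGen S)) :
    0 ≤ ∑ i, c i * ξ i := by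
  have hclosed : IsClosed {ξ : Fin n → ℝ | 0 ≤ c ⬝ᵥ ξ} :=
    isClosed_le continuous_const (by unfold dotProduct; fun_prop)
  refine closure_minimal ?_ hclosed hξ
  rintro _ ⟨s, t, v, ht, hv, rfl⟩
  simp only [Set.mem_ofPred_eq, dotProduct_sum, dotProduct_smul]
  exact Finset.sum_nonneg fun i _ => smul_nonneg (ht i) (hc _ (hv i))

theorem exists_algebra_of_closure_coneGen_isSpectrahedralShadow
    (n : ℕ) (S : Set (Fin n → ℝ)) (hS : IsSemialgebraic S)
    (hshadow : IsSpectrahedralShadow (closure (coneGen S))) :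
    ∃ (A : Type) (_ : CommRing A) (_ : Algebra ℝ A),
      Algebra.FiniteType ℝ A ∧ IsReduced A ∧
      ∃ (a : Fin n → A) (U : Submodule ℝ A), FiniteDimensional ℝ U ∧
        (∀ ξ ∈ S, ∃ ρ : A →ₐ[ℝ] ℝ, ∀ i, ρ (a i) = ξ i) ∧
        (∀ c : Fin n → ℝ, (∀ ξ ∈ S, 0 ≤ ∑ i, c i * ξ i) →
          IsSumOfSquaresFrom U (∑ i, c i • a i)) := by
  obtain ⟨d, m, -, A, B, C, -, -, -, hK⟩ := hshadow
  let M (ξ : Fin n → ℝ) (η : Fin m → ℝ) : Matrix (Fin d) (Fin d) ℝ :=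
    A + ∑ i, ξ i • B i + ∑ j, η j • C j
  let Z : Type := {p : (Fin n → ℝ) × (Fin m → ℝ) × Matrix (Fin d) (Fin d) ℝ //
    M p.1 p.2.1 = p.2.2 * p.2.2.transpose}
  have hpoint {ξ} (hξ : ξ ∈ closure (coneGen S)) : ∃ z : Z, z.1.1 = ξ := by
    obtain ⟨η, hη⟩ := hK.le hξ
    obtain ⟨W, hW⟩ := Matrix.posSemidef_iff_exists_transpose_mul_self.mp hη
    exact ⟨⟨(ξ, η, W.transpose), by simpa [M] using hW⟩, rfl⟩
  let V (z : Z) : Matrix (Fin d ⊕ Unit) (Fin d ⊕ Unit) ℝ := Matrix.fromBlocks z.1.2.2 0 0 1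
  refine exists_algebra_of_functions S (fun i z => z.1.1 i) V
    (fun ξ hξ => ?_) (fun c hc => ?_)
  · obtain ⟨z, rfl⟩ := hpoint (subset_closure (subset_coneGen S hξ))
    exact ⟨z, fun _ => rfl⟩
  refine (exists_sum_sq_or_exists_functional V _).resolve_right ?_
  rintro ⟨ℓ, hneg, hpsd⟩
  have hVV (z : Z) : V z * (V z).transpose = Matrix.fromBlocks (M z.1.1 z.1.2.1) 0 0 1 := by
    simp [V, Matrix.fromBlocks_transpose, Matrix.fromBlocks_multiply, z.2]
  simp only [hVV] at hpsd
  let τ : ℝ := ℓ fun _ => 1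
  let x (i : Fin n) : ℝ := ℓ fun z => z.1.1 i
  let y (j : Fin m) : ℝ := ℓ fun z => z.1.2.1 j
  have hτ : 0 ≤ τ := by simpa [τ] using hpsd.diag_nonneg (i := Sum.inr ())
  have hN : (τ • A + ∑ i, x i • B i + ∑ j, y j • C j).PosSemidef := by
    convert hpsd.submatrix Sum.inl using 1
    ext k l
    have hfun : (fun z : Z => M z.1.1 z.1.2.1 k l) = (A k l • fun _ => 1)
        + ∑ i, (B i k l • fun z : Z => z.1.1 i) + ∑ j, (C j k l • fun z : Z => z.1.2.1 j) := by
      ext z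
      simp [M, Matrix.sum_apply, mul_comm]
    simp only [Matrix.submatrix_apply, Matrix.of_apply, Matrix.fromBlocks_apply₁₁, hfun, map_add,
      map_sum, map_smul]
    simp [Matrix.sum_apply, mul_comm, τ, x, y]
  have hcx : ∑ i, c i * x i < 0 := by
    have hfun : (fun z : Z => ∑ i, c i * z.1.1 i) = ∑ i, c i • fun z : Z => z.1.1 i := by
      ext z
      simp
    rw [hfun] at hneg
    simpa [x] using hneg
  obtain ⟨z₀, hz₀⟩ := hpoint (subset_closure (zero_mem_coneGen S))
  have hM₀ : (M z₀.1.1 z₀.1.2.1).PosSemidef := by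
    rw [z₀.2]
    simpa using Matrix.posSemidef_self_mul_conjTranspose z₀.1.2.2
  have hpos : 0 < τ + 1 := by positivity
  have hmem : (τ + 1)⁻¹ • x ∈ closure (coneGen S) := by
    rw [hK]
    refine ⟨(τ + 1)⁻¹ • (y + z₀.1.2.1), ?_⟩
    convert (hN.add hM₀).smul (inv_nonneg.mpr hpos.le) using 1
    have hA : A = (τ + 1)⁻¹ • (τ • A + A) := by
      rw [show τ • A + A = (τ + 1) • A by rw [add_smul, one_smul], smul_smul,
        inv_mul_cancel₀ hpos.ne', one_smul]
    nth_rewrite 1 [hA]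
    simp only [M, hz₀, Pi.smul_apply, Pi.add_apply, Pi.zero_apply, smul_add, smul_assoc, add_smul,
      Finset.sum_add_distrib, Finset.smul_sum, zero_smul, smul_zero, Finset.sum_const_zero]
    abel
  have hnonneg := dotProduct_nonneg_of_mem_closure_coneGen hc hmem
  have hscale : ∑ i, c i * ((τ + 1)⁻¹ • x) i = (τ + 1)⁻¹ * ∑ i, c i * x i := by
    simp only [Pi.smul_apply, smul_eq_mul, Finset.mul_sum]
    exact Finset.sum_congr rfl fun i _ => by ring
  rw [hscale] at hnonneg
  exact hnonneg.not_gt (mul_neg_of_pos_of_neg (inv_pos.mpr hpos) hcx)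
end

section
/- Let S ⊆ ℝ^n be a semialgebraic set, let L ⊆ ℝ[x_1,…,x_n] be a finite-dimensional ℝ-linear subspace with 1 ∉ L, fix a basis g_1, …, g_k of L, and let φ_L : ℝ^n → ℝ^k be given by φ_L(ξ) = (g_1(ξ),…,g_k(ξ)). Suppose that for i = 1, …, m there are given a commutative ℝ-algebra A_i, elements a^{(i)}_1, …, a^{(i)}_n ∈ A_i, and a finite-dimensional ℝ-linear subspace U_i ⊆ A_i, such that: (1) for every ξ ∈ S and every i there exists an ℝ-algebra homomorphism ρ : A_i → ℝ with ρ(a^{(i)}_j) = ξ_j for j = 1, …, n; and (2) for every f ∈ L with f(ξ) ≥ 0 for all ξ ∈ S there exists an index i such that the element f(a^{(i)}_1,…,a^{(i)}_n) of A_i is a sum of squares of elements of U_i. Then the closure of the convex cone generated by φ_L(S) in ℝ^k is a spectrahedral shadow. -/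
/-- A commutative `ℝ`-algebra together with `n` distinguished elements and a distinguished
linear subspace. -/
structure AlgebraicData (n : ℕ) where
  carrier : Type
  [commRing : CommRing carrier]
  [alg : Algebra ℝ carrier]
  elem : Fin n → carrier
  U : Submodule ℝ carrier

attribute [instance] AlgebraicData.commRing AlgebraicData.alg

section LinearMatrixInequalities

variable {k : ℕ}

theorem isSpectrahedralShadow_of_bilinForm {F V : Type*} [AddCommGroup F] [Module ℝ F]
    [FiniteDimensional ℝ F] [AddCommGroup V] [Module ℝ V] [FiniteDimensional ℝ V] [Nontrivial V]
    (Q : ((Fin k → ℝ) × F) →ₗ[ℝ] V →ₗ[ℝ] V →ₗ[ℝ] ℝ) (hQ : ∀ p v w, Q p v w = Q p w v) :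
    IsSpectrahedralShadow {x | ∃ η, ∀ v, 0 ≤ Q (x, η) v v} := by
  set e := Module.finBasis ℝ V
  set f := Module.finBasis ℝ F
  let M : ((Fin k → ℝ) × F) → Matrix (Fin (Module.finrank ℝ V)) (Fin (Module.finrank ℝ V)) ℝ :=
    fun p ↦ Matrix.of fun a b ↦ Q p (e a) (e b)
  have hsymm (p) : (M p).IsSymm := Matrix.IsSymm.ext fun a b ↦ hQ p _ _
  have hsum (x : Fin k → ℝ) (η : Fin (Module.finrank ℝ F) → ℝ) :
      0 + ∑ i, x i • M (Pi.single i 1, 0) + ∑ j, η j • M (0, f j) =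
        M (x, ∑ j, η j • f j) := by
    have hp : (x, ∑ j, η j • f j) =
        ∑ i, x i • ((Pi.single i 1, 0) : (Fin k → ℝ) × F) +
          ∑ j, η j • ((0, f j) : (Fin k → ℝ) × F) := by
      ext
      · simp [Prod.fst_sum, Finset.sum_apply, Pi.single_apply]
      · simp [Prod.snd_sum]
    ext a b
    simp only [M, hp, Matrix.add_apply, Matrix.sum_apply, Matrix.smul_apply, Matrix.of_apply,
      map_add, map_sum, map_smul, LinearMap.add_apply, LinearMap.sum_apply, LinearMap.smul_apply,
      zero_add]
  have hpsd (p) : (M p).PosSemidef ↔ ∀ v, 0 ≤ Q p v v := by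
    have hform (c : Fin (Module.finrank ℝ V) → ℝ) :
        star c ⬝ᵥ (M p).mulVec c = Q p (∑ a, c a • e a) (∑ a, c a • e a) := by
      simp only [dotProduct, Matrix.mulVec, M, Matrix.of_apply, map_sum, map_smul,
        LinearMap.sum_apply, LinearMap.smul_apply, smul_eq_mul, star_trivial, Finset.mul_sum]
      rw [Finset.sum_comm]
      exact Finset.sum_congr rfl fun _ _ ↦ Finset.sum_congr rfl fun _ _ ↦ by ring
    rw [Matrix.posSemidef_iff_dotProduct_mulVec]
    refine ⟨fun h v ↦ ?_, fun h ↦ ⟨?_, fun c ↦ ?_⟩⟩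
    · have := h.2 (e.repr v)
      rwa [hform, e.sum_repr] at this
    · rw [Matrix.IsHermitian, Matrix.conjTranspose_eq_transpose_of_trivial]
      exact hsymm p
    · rw [hform]
      exact h _
  refine ⟨_, _, Module.finrank_pos (R := ℝ) (M := V), 0, fun i ↦ M (Pi.single i 1, 0),
    fun j ↦ M (0, f j), Matrix.isSymm_zero, fun _ ↦ hsymm _, fun _ ↦ hsymm _, ?_⟩
  ext x
  simp only [Set.mem_ofPred_eq, hsum, hpsd]
  constructor
  · rintro ⟨η, h⟩
    exact ⟨f.repr η, by rwa [f.sum_repr]⟩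
  · rintro ⟨η, h⟩
    exact ⟨_, h⟩

theorem isSpectrahedralShadow_of_forall_bilinForm {ι : Type*} [Fintype ι] {F V : ι → Type*}
    [∀ i, AddCommGroup (F i)] [∀ i, Module ℝ (F i)] [∀ i, FiniteDimensional ℝ (F i)]
    [∀ i, AddCommGroup (V i)] [∀ i, Module ℝ (V i)] [∀ i, FiniteDimensional ℝ (V i)]
    (Q : ∀ i, ((Fin k → ℝ) × F i) →ₗ[ℝ] V i →ₗ[ℝ] V i →ₗ[ℝ] ℝ)
    (hQ : ∀ i p v w, Q i p v w = Q i p w v) :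
    IsSpectrahedralShadow {x | ∀ i, ∃ η, ∀ v, 0 ≤ Q i (x, η) v v} := by
  classical
  let π (i : ι) : ((∀ i, V i) × ℝ) →ₗ[ℝ] V i := LinearMap.proj i ∘ₗ LinearMap.fst ℝ _ _
  let R (p : (Fin k → ℝ) × ∀ i, F i) := ∑ i, (Q i (p.1, p.2 i)).compl₁₂ (π i) (π i)
  have hR (p v w) : R p v w = ∑ i, Q i (p.1, p.2 i) (v.1 i) (w.1 i) := by
    simp [R, π, LinearMap.sum_apply]
  have hlin : IsLinearMap ℝ R := by
    constructor
    · intro p q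
      refine LinearMap.ext₂ fun v w ↦ ?_
      simp only [hR, LinearMap.add_apply, ← Finset.sum_add_distrib]
      refine Finset.sum_congr rfl fun i _ ↦ ?_
      rw [← LinearMap.add_apply, ← LinearMap.add_apply, ← map_add]
      rfl
    · intro c p
      refine LinearMap.ext₂ fun v w ↦ ?_
      simp only [hR, LinearMap.smul_apply, Finset.smul_sum]
      refine Finset.sum_congr rfl fun i _ ↦ ?_
      rw [← LinearMap.smul_apply, ← LinearMap.smul_apply, ← map_smul]
      rfl
  have := isSpectrahedralShadow_of_bilinForm (hlin.mk' R) fun p v w ↦ by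
    simp only [IsLinearMap.mk'_apply, hR]
    exact Finset.sum_congr rfl fun i _ ↦ hQ i _ _ _
  convert this using 1
  ext x
  simp only [Set.mem_ofPred_eq, IsLinearMap.mk'_apply, hR]
  constructor
  · intro h
    choose η hη using h
    exact ⟨η, fun v ↦ Finset.sum_nonneg fun i _ ↦ hη i _⟩
  · rintro ⟨η, hη⟩ i
    refine ⟨η i, fun v ↦ ?_⟩
    have := hη (Pi.single i v, 0)
    rw [Finset.sum_eq_single i (fun j _ hj ↦ by simp [Pi.single_eq_of_ne hj])
      (by simp)] at this
    change 0 ≤ Q i (x, η i) ((Pi.single i v : ∀ i, V i) i) ((Pi.single i v : ∀ i, V i) i) at this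
    rwa [Pi.single_eq_same] at this

theorem isSpectrahedralShadow_of_forall_exists_dual {ι : Type*} [Fintype ι] {E V : ι → Type*}
    [∀ i, AddCommGroup (E i)] [∀ i, Module ℝ (E i)] [∀ i, FiniteDimensional ℝ (E i)]
    [∀ i, AddCommGroup (V i)] [∀ i, Module ℝ (V i)] [∀ i, FiniteDimensional ℝ (V i)]
    (T : ∀ i, (Fin k → ℝ) →ₗ[ℝ] E i) (μ : ∀ i, V i →ₗ[ℝ] V i →ₗ[ℝ] E i)
    (hμ : ∀ i v w, μ i v w = μ i w v) :
    IsSpectrahedralShadow {x | ∀ i, ∃ l : Module.Dual ℝ (E i),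
      (∀ c, l (T i c) = Fintype.linearCombination ℝ x c) ∧ ∀ v, 0 ≤ l (μ i v v)} := by
  let d (i : ι) (p : (Fin k → ℝ) × Module.Dual ℝ (E i)) : (Fin k → ℝ) →ₗ[ℝ] ℝ :=
    Fintype.linearCombination ℝ p.1 - p.2 ∘ₗ T i
  have d_add (i p q c) : d i (p + q) c = d i p c + d i q c := by
    simp only [d, Fintype.linearCombination_apply, LinearMap.sub_apply, LinearMap.comp_apply,
      Prod.fst_add, Prod.snd_add, Pi.add_apply, smul_add, Finset.sum_add_distrib,
      LinearMap.add_apply]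
    ring
  have d_smul (i) (a : ℝ) (p c) : d i (a • p) c = a * d i p c := by
    simp only [d, Fintype.linearCombination_apply, LinearMap.sub_apply, LinearMap.comp_apply,
      Prod.smul_fst, Prod.smul_snd, Pi.smul_apply, LinearMap.smul_apply, smul_eq_mul, mul_sub,
      Finset.mul_sum, mul_left_comm]
  let R (i : ι) (p : (Fin k → ℝ) × Module.Dual ℝ (E i)) :=
    LinearMap.mk₂ ℝ (fun v w : V i × (Fin k → ℝ) × ℝ ↦
      p.2 (μ i v.1 w.1) + (v.2.2 * d i p w.2.1 + w.2.2 * d i p v.2.1))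
      (by intros; simp only [Prod.fst_add, Prod.snd_add, map_add, LinearMap.add_apply]; ring)
      (by intros; simp only [Prod.smul_fst, Prod.smul_snd, map_smul, LinearMap.smul_apply,
            smul_eq_mul]; ring)
      (by intros; simp only [Prod.fst_add, Prod.snd_add, map_add]; ring)
      (by intros; simp only [Prod.smul_fst, Prod.smul_snd, map_smul, smul_eq_mul]; ring)
  have hR (i p v w) : R i p v w =
    p.2 (μ i v.1 w.1) + (v.2.2 * d i p w.2.1 + w.2.2 * d i p v.2.1) := rfl
  have hlin (i) : IsLinearMap ℝ (R i) := by
    constructor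
    · intro p q
      refine LinearMap.ext₂ fun v w ↦ ?_
      simp only [hR, LinearMap.add_apply, d_add, Prod.snd_add]
      ring
    · intro c p
      refine LinearMap.ext₂ fun v w ↦ ?_
      simp only [hR, LinearMap.smul_apply, d_smul, Prod.smul_snd, smul_eq_mul]
      ring
  have := isSpectrahedralShadow_of_forall_bilinForm (fun i ↦ (hlin i).mk' (R i))
    fun i p v w ↦ by
      simp only [IsLinearMap.mk'_apply, hR, hμ i v.1]
      ring
  convert this using 1
  ext x
  simp only [Set.mem_ofPred_eq, IsLinearMap.mk'_apply, hR]
  refine forall_congr' fun i ↦ exists_congr fun l ↦ ⟨fun h v ↦ ?_, fun h ↦ ⟨fun c ↦ ?_, fun v ↦ ?_⟩⟩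
  · have hd (c) : d i (x, l) c = 0 := by simp [d, h.1 c]
    simpa [hd] using h.2 v.1
  · have h₁ := h (0, c, 1)
    have h₂ := h (0, c, -1)
    simp only [map_zero, one_mul, zero_add, neg_mul] at h₁ h₂
    have : d i (x, l) c = 0 := by linarith
    simp only [d, LinearMap.sub_apply, LinearMap.comp_apply] at this
    linarith
  · simpa using h (v, 0, 0)

end LinearMatrixInequalities

/-- M. Riesz extension along a linear map `T`: a functional `φ` that is nonnegative on the preimage
of a cone `s` factors through a functional nonnegative on `s`. -/
theorem exists_extension_of_nonneg_comap {E W : Type*} [AddCommGroup E] [Module ℝ E]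
    [AddCommGroup W] [Module ℝ W] (s : PointedCone ℝ E) (T : W →ₗ[ℝ] E) (φ : W →ₗ[ℝ] ℝ)
    (nonneg : ∀ c, T c ∈ s → 0 ≤ φ c) (dense : ∀ y, ∃ c, T c + y ∈ s) :
    ∃ l : E →ₗ[ℝ] ℝ, (∀ c, l (T c) = φ c) ∧ ∀ y ∈ s, 0 ≤ l y := by
  obtain ⟨σ, hσ⟩ := T.rangeRestrict.exists_rightInverse_of_surjective T.range_rangeRestrict
  have hσ' (y : T.range) : T (σ y) = y := congrArg Subtype.val (LinearMap.congr_fun hσ y)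
  have hker (c) (hc : T c = 0) : φ c = 0 := by
    have h₁ := nonneg c (by rw [hc]; exact s.zero_mem)
    have h₂ := nonneg (-c) (by rw [map_neg, hc, neg_zero]; exact s.zero_mem)
    rw [map_neg] at h₂
    linarith
  obtain ⟨l, hl, hpos⟩ := riesz_extension s ⟨T.range, φ ∘ₗ σ⟩
    (fun x hx ↦ nonneg (σ x) (by rwa [hσ' x])) fun y ↦ by
      obtain ⟨c, hc⟩ := dense y
      exact ⟨⟨T c, T.mem_range_self c⟩, hc⟩
  refine ⟨l, fun c ↦ ?_, hpos⟩
  have : l (T c) = φ (σ ⟨T c, T.mem_range_self c⟩) := hl ⟨T c, T.mem_range_self c⟩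
  rw [this, ← sub_eq_zero, ← map_sub]
  exact hker _ (by rw [map_sub, hσ', sub_self])

section SumsOfSquares

variable {A : Type*} [CommRing A] [Algebra ℝ A] {U : Submodule ℝ A}

namespace IsSumOfSquaresFrom

theorem zero : IsSumOfSquaresFrom U 0 := ⟨0, Fin.elim0, fun i ↦ i.elim0, by simp⟩

theorem sq {u : A} (hu : u ∈ U) : IsSumOfSquaresFrom U (u ^ 2) :=
  ⟨1, fun _ ↦ u, fun _ ↦ hu, by simp⟩

theorem add {x y : A} (hx : IsSumOfSquaresFrom U x) (hy : IsSumOfSquaresFrom U y) :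
    IsSumOfSquaresFrom U (x + y) := by
  obtain ⟨s, u, hu, rfl⟩ := hx
  obtain ⟨t, v, hv, rfl⟩ := hy
  refine ⟨s + t, Fin.append u v, fun i ↦ ?_, by simp [Fin.sum_univ_add]⟩
  refine Fin.addCases (fun j ↦ ?_) (fun j ↦ ?_) i
  · simpa using hu j
  · simpa using hv j

theorem sum {ι : Type*} {s : Finset ι} {x : ι → A} (h : ∀ i ∈ s, IsSumOfSquaresFrom U (x i)) :
    IsSumOfSquaresFrom U (∑ i ∈ s, x i) :=
  Finset.sum_induction _ _ (fun _ _ ↦ add) zero h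

theorem smul {c : ℝ} (hc : 0 ≤ c) {x : A} (hx : IsSumOfSquaresFrom U x) :
    IsSumOfSquaresFrom U (c • x) := by
  obtain ⟨s, u, hu, rfl⟩ := hx
  refine ⟨s, fun i ↦ √c • u i, fun i ↦ U.smul_mem _ (hu i), ?_⟩
  simp [smul_pow, Real.sq_sqrt hc, Finset.smul_sum]

theorem map_nonneg {x : A} (hx : IsSumOfSquaresFrom U x) (ρ : A →ₐ[ℝ] ℝ) : 0 ≤ ρ x := by
  obtain ⟨s, u, -, rfl⟩ := hx
  simpa using Finset.sum_nonneg fun i _ ↦ sq_nonneg (ρ (u i))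

end IsSumOfSquaresFrom

/-- The span of all elements of `U` that occur in a representation of an element of `R` as a sum
of squares of elements of `U`. -/
def sosSupport (U R : Submodule ℝ A) : Submodule ℝ A :=
  Submodule.span ℝ {u | u ∈ U ∧ ∃ w, IsSumOfSquaresFrom U w ∧ u ^ 2 + w ∈ R}

variable {R : Submodule ℝ A}

theorem sosSupport_le : sosSupport U R ≤ U := Submodule.span_le.2 fun _ hu ↦ hu.1

theorem IsSumOfSquaresFrom.mono {U' : Submodule ℝ A} (hU : U ≤ U') {x : A}
    (hx : IsSumOfSquaresFrom U x) : IsSumOfSquaresFrom U' x := by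
  obtain ⟨s, u, hu, rfl⟩ := hx
  exact ⟨s, u, fun i ↦ hU (hu i), rfl⟩

theorem IsSumOfSquaresFrom.sosSupport_of_add_mem {x y : A} (hx : IsSumOfSquaresFrom U x)
    (hy : IsSumOfSquaresFrom U y) (hxy : x + y ∈ R) :
    IsSumOfSquaresFrom (sosSupport U R) x := by
  obtain ⟨s, u, hu, rfl⟩ := hx
  refine ⟨s, u, fun i ↦ Submodule.subset_span ⟨hu i, ∑ j ∈ Finset.univ.erase i, u j ^ 2 + y,
    .add (.sum fun j _ ↦ .sq (hu j)) hy, ?_⟩, rfl⟩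
  rwa [← add_assoc, Finset.add_sum_erase _ (fun j ↦ u j ^ 2) (Finset.mem_univ i)]

theorem exists_mem_isSumOfSquaresFrom_sub_sq {u : A} (hu : u ∈ sosSupport U R) :
    ∃ r ∈ R, IsSumOfSquaresFrom (sosSupport U R) (r - u ^ 2) := by
  induction hu using Submodule.span_induction with
  | mem u hu =>
    obtain ⟨hu, w, hw, hR⟩ := hu
    refine ⟨_, hR, ?_⟩
    rw [add_sub_cancel_left]
    exact hw.sosSupport_of_add_mem (.sq hu) (by rwa [add_comm])
  | zero => exact ⟨0, R.zero_mem, by simpa using .zero⟩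
  | add u v hu hv ihu ihv =>
    obtain ⟨r, hr, h⟩ := ihu
    obtain ⟨r', hr', h'⟩ := ihv
    refine ⟨(2 : ℝ) • (r + r'), R.smul_mem _ (R.add_mem hr hr'), ?_⟩
    convert ((h.add h').smul zero_le_two).add (.sq (Submodule.sub_mem _ hu hv)) using 1
    simp only [two_smul]
    ring
  | smul a u hu ih =>
    obtain ⟨r, hr, h⟩ := ih
    refine ⟨a ^ 2 • r, R.smul_mem _ hr, ?_⟩
    rw [smul_pow, ← smul_sub]
    exact h.smul (sq_nonneg a)

theorem exists_mem_isSumOfSquaresFrom_add {y : A}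
    (hy : y ∈ R ⊔ sosSupport U R * sosSupport U R) :
    ∃ r ∈ R, IsSumOfSquaresFrom (sosSupport U R) (r + y) := by
  obtain ⟨r₀, hr₀, p, hp, rfl⟩ := Submodule.mem_sup.1 hy
  suffices ∃ r ∈ R, IsSumOfSquaresFrom (sosSupport U R) (r + p) by
    obtain ⟨r, hr, h⟩ := this
    exact ⟨r - r₀, R.sub_mem hr hr₀, by simpa [← add_assoc] using h⟩
  refine Submodule.mul_induction_on hp (fun u hu v hv ↦ ?_) fun x y ihx ihy ↦ ?_
  · obtain ⟨r, hr, h⟩ := exists_mem_isSumOfSquaresFrom_sub_sq hu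
    obtain ⟨r', hr', h'⟩ := exists_mem_isSumOfSquaresFrom_sub_sq hv
    refine ⟨(1 / 2 : ℝ) • (r + r'), R.smul_mem _ (R.add_mem hr hr'), ?_⟩
    convert ((h.add h').add (.sq (Submodule.add_mem _ hu hv))).smul
      (by norm_num : (0 : ℝ) ≤ 1 / 2) using 1
    have : u * v = (1 / 2 : ℝ) • ((2 : ℝ) • (u * v)) := by
      rw [smul_smul]
      norm_num
    rw [this, ← smul_add, two_smul]
    congr 1
    ring
  · obtain ⟨r, hr, h⟩ := ihx
    obtain ⟨r', hr', h'⟩ := ihy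
    exact ⟨r + r', R.add_mem hr hr', by convert h.add h' using 1; ring⟩

/-- The space spanned by `R` and all products of elements of `sosSupport U R`. -/
abbrev sosSpace (U R : Submodule ℝ A) : Submodule ℝ A := R ⊔ sosSupport U R * sosSupport U R

/-- Multiplication on `sosSupport U R`, with values in `sosSpace U R`. -/
def sosMul (U R : Submodule ℝ A) :
    sosSupport U R →ₗ[ℝ] sosSupport U R →ₗ[ℝ] sosSpace U R :=
  LinearMap.mk₂ ℝ
    (fun u v ↦ ⟨u * v, Submodule.mem_sup_right (Submodule.mul_mem_mul u.2 v.2)⟩)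
    (fun _ _ _ ↦ Subtype.ext (add_mul _ _ _)) (fun _ _ _ ↦ Subtype.ext (smul_mul_assoc _ _ _))
    (fun _ _ _ ↦ Subtype.ext (mul_add _ _ _)) (fun _ _ _ ↦ Subtype.ext (mul_smul_comm _ _ _))

theorem coe_sosMul (u v : sosSupport U R) : (sosMul U R u v : A) = u * v := rfl

theorem sosMul_comm (u v : sosSupport U R) : sosMul U R u v = sosMul U R v u :=
  Subtype.ext (mul_comm _ _)

theorem finiteDimensional_sosSpace [FiniteDimensional ℝ U] [FiniteDimensional ℝ R] :
    FiniteDimensional ℝ (sosSpace U R) := by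
  have := Submodule.finiteDimensional_of_le (sosSupport_le (U := U) (R := R))
  have : FiniteDimensional ℝ ↥(sosSupport U R * sosSupport U R) :=
    Module.Finite.iff_fg.2 (.mul (Module.Finite.iff_fg.1 this) (Module.Finite.iff_fg.1 this))
  infer_instance

/-- The cone of sums of squares of elements of `sosSupport U R` inside `sosSpace U R`. -/
def sosCone (U R : Submodule ℝ A) : PointedCone ℝ (sosSpace U R) where
  carrier := {y | IsSumOfSquaresFrom (sosSupport U R) (y : A)}
  zero_mem' := .zero
  add_mem' h h' := h.add h'
  smul_mem' c _ h := h.smul c.2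

theorem mem_sosCone {y : sosSpace U R} :
    y ∈ sosCone U R ↔ IsSumOfSquaresFrom (sosSupport U R) (y : A) := Iff.rfl

/-- A linear functional that is nonnegative on the preimage of the sums of squares extends to a
functional on `sosSpace` that is nonnegative on squares, and conversely. -/
theorem forall_isSumOfSquaresFrom_nonneg_iff {W : Type*} [AddCommGroup W] [Module ℝ W]
    (T : W →ₗ[ℝ] A) (φ : W →ₗ[ℝ] ℝ) :
    (∀ c, IsSumOfSquaresFrom U (T c) → 0 ≤ φ c) ↔
      ∃ l : Module.Dual ℝ (sosSpace U T.range),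
        (∀ c, l (T.codRestrict _ (fun c ↦ Submodule.mem_sup_left (T.mem_range_self c)) c) = φ c) ∧
        ∀ u, 0 ≤ l (sosMul U T.range u u) := by
  set T' : W →ₗ[ℝ] sosSpace U T.range :=
    T.codRestrict _ (fun c ↦ Submodule.mem_sup_left (T.mem_range_self c))
  have coe_T' (c) : (T' c : A) = T c := rfl
  constructor
  · intro h
    obtain ⟨l, hl, hpos⟩ := exists_extension_of_nonneg_comap (sosCone U T.range) T' φ
      (fun c hc ↦ h c ((mem_sosCone.1 hc).mono sosSupport_le)) fun y ↦ by
        obtain ⟨_, ⟨c, rfl⟩, hc⟩ := exists_mem_isSumOfSquaresFrom_add y.2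
        exact ⟨c, hc⟩
    refine ⟨l, hl, fun u ↦ hpos _ ?_⟩
    rw [mem_sosCone, coe_sosMul, ← sq]
    exact .sq u.2
  · rintro ⟨l, hl, hpos⟩ c hc
    have hc' := hc.sosSupport_of_add_mem (R := T.range) .zero (by simp)
    obtain ⟨s, u, hu, hsum⟩ := hc'
    have : T' c = ∑ i, sosMul U T.range ⟨u i, hu i⟩ ⟨u i, hu i⟩ := by
      apply Subtype.ext
      simp [coe_T', hsum, coe_sosMul, sq]
    rw [← hl, this, map_sum]
    exact Finset.sum_nonneg fun i _ ↦ hpos _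

end SumsOfSquares

theorem coneGen_eq_span {k : ℕ} (M : Set (Fin k → ℝ)) :
    coneGen M = (PointedCone.hull ℝ M : Set (Fin k → ℝ)) := by
  ext x
  rw [SetLike.mem_coe, PointedCone.hull, Submodule.mem_span_set']
  constructor
  · rintro ⟨s, c, v, hc, hv, rfl⟩
    exact ⟨s, fun i ↦ ⟨c i, hc i⟩, fun i ↦ ⟨v i, hv i⟩, rfl⟩
  · rintro ⟨s, c, v, rfl⟩
    exact ⟨s, fun i ↦ c i, fun i ↦ v i, fun i ↦ (c i).2, fun i ↦ (v i).2, rfl⟩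

theorem mem_closure_coneGen_iff {k : ℕ} {M : Set (Fin k → ℝ)} {x : Fin k → ℝ} :
    x ∈ closure (coneGen M) ↔
      ∀ c, (∀ y ∈ M, 0 ≤ Fintype.linearCombination ℝ y c) →
        0 ≤ Fintype.linearCombination ℝ x c := by
  simp only [Fintype.linearCombination_apply, smul_eq_mul]
  constructor
  · intro hx c hc
    have hclosed : IsClosed {y : Fin k → ℝ | 0 ≤ ∑ i, c i * y i} :=
      isClosed_le continuous_const (by fun_prop)
    refine closure_minimal ?_ hclosed hx
    rintro _ ⟨s, a, v, ha, hv, rfl⟩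
    have : ∑ i, c i * (∑ j, a j • v j) i = ∑ j, a j * ∑ i, c i * v j i := by
      simp only [Finset.sum_apply, Pi.smul_apply, smul_eq_mul, Finset.mul_sum]
      rw [Finset.sum_comm]
      exact Finset.sum_congr rfl fun _ _ ↦ Finset.sum_congr rfl fun _ _ ↦ by ring
    simp only [Set.mem_ofPred_eq, this]
    exact Finset.sum_nonneg fun j _ ↦ mul_nonneg (ha j) (hc _ (hv j))
  · intro h
    by_contra hx
    rw [coneGen_eq_span] at hx
    obtain ⟨f, hf, hfx⟩ := ProperCone.hyperplane_separation_point
      (⟨(PointedCone.hull ℝ M).closure, isClosed_closure⟩ : ProperCone ℝ (Fin k → ℝ)) hx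
    have hf_eq (y : Fin k → ℝ) : f y = ∑ i, f (Pi.single i 1) * y i := by
      conv_lhs => rw [pi_eq_sum_univ' y]
      simp [map_sum, mul_comm, Pi.single]
    refine hfx.not_ge ?_
    rw [hf_eq]
    refine h _ fun y hy ↦ ?_
    rw [← hf_eq]
    exact hf y (subset_closure (Submodule.subset_span hy))

theorem isSpectrahedralShadow_closure_coneGen_of_sos
    (n : ℕ) (S : Set (Fin n → ℝ)) (hS : IsSemialgebraic S)
    (L : Submodule ℝ (MvPolynomial (Fin n) ℝ)) (hL : FiniteDimensional ℝ L)
    (h1 : (1 : MvPolynomial (Fin n) ℝ) ∉ L)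
    (k : ℕ) (g : Fin k → MvPolynomial (Fin n) ℝ)
    (hgL : ∀ i, g i ∈ L) (hspan : Submodule.span ℝ (Set.range g) = L)
    (hind : LinearIndependent ℝ g)
    (m : ℕ) (D : Fin m → AlgebraicData n)
    (hU : ∀ i, FiniteDimensional ℝ (D i).U)
    (hpoint : ∀ ξ ∈ S, ∀ i, ∃ ρ : (D i).carrier →ₐ[ℝ] ℝ, ∀ j, ρ ((D i).elem j) = ξ j)
    (hsos : ∀ f ∈ L, (∀ ξ ∈ S, 0 ≤ MvPolynomial.eval ξ f) →
      ∃ i, IsSumOfSquaresFrom (D i).U (MvPolynomial.aeval (D i).elem f)) :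
    IsSpectrahedralShadow
      (closure (coneGen ((fun ξ => fun i => MvPolynomial.eval ξ (g i)) '' S))) := by
  classical
  let T (i : Fin m) : (Fin k → ℝ) →ₗ[ℝ] (D i).carrier :=
    (MvPolynomial.aeval (D i).elem).toLinearMap ∘ₗ Fintype.linearCombination ℝ g
  have heval (ξ : Fin n → ℝ) (c : Fin k → ℝ) :
      Fintype.linearCombination ℝ (fun i ↦ MvPolynomial.eval ξ (g i)) c =
        MvPolynomial.eval ξ (Fintype.linearCombination ℝ g c) := by
    simp [Fintype.linearCombination_apply, MvPolynomial.smul_eval]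
  have hnonneg (c : Fin k → ℝ) :
      (∀ ξ ∈ S, 0 ≤ MvPolynomial.eval ξ (Fintype.linearCombination ℝ g c)) ↔
        ∃ i, IsSumOfSquaresFrom (D i).U (T i c) := by
    constructor
    · refine hsos _ ?_
      rw [Fintype.linearCombination_apply]
      exact L.sum_mem fun i _ ↦ L.smul_mem _ (hgL i)
    · rintro ⟨i, hi⟩ ξ hξ
      obtain ⟨ρ, hρ⟩ := hpoint ξ hξ i
      have hcomp : ρ.comp (MvPolynomial.aeval (D i).elem) = MvPolynomial.aeval ξ :=
        MvPolynomial.algHom_ext fun j ↦ by simp [hρ]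
      have := hi.map_nonneg ρ
      rwa [show ρ (T i c) = _ from DFunLike.congr_fun hcomp _, MvPolynomial.aeval_eq_eval] at this
  have hfin (i) : FiniteDimensional ℝ (sosSpace (D i).U (T i).range) :=
    have := hU i
    finiteDimensional_sosSpace
  have hfin' (i) : FiniteDimensional ℝ (sosSupport (D i).U (T i).range) :=
    have := hU i
    Submodule.finiteDimensional_of_le sosSupport_le
  convert isSpectrahedralShadow_of_forall_exists_dual
    (fun i ↦ (T i).codRestrict (sosSpace (D i).U (T i).range)
      fun c ↦ Submodule.mem_sup_left ((T i).mem_range_self c))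
    (fun i ↦ sosMul (D i).U (T i).range) (fun _ ↦ sosMul_comm) using 1
  ext x
  simp only [mem_closure_coneGen_iff, Set.forall_mem_image, heval, hnonneg, Set.mem_ofPred_eq,
    ← forall_isSumOfSquaresFrom_nonneg_iff]
  exact ⟨fun h i c hc ↦ h c ⟨i, hc⟩, fun h c ⟨i, hc⟩ ↦ h i c hc⟩
end
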